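/- For each integer n ≥ 1 there is a constant C_n > 0 such that for every integer k ≥ 1, every closed ball B ⊆ ℝ^k, every L > 0, and every L-Lipschitz map f : ∂B → ℝ^(n) (where ∂B is the boundary sphere of B and ℝ^(n) carries the Hausdorff metric), there exists a C_n·L-Lipschitz map f̃ : B → ℝ^(n) that agrees with f on ∂B. -/

import Mathlib

open Metric

lemma aux_phi (S : Set ℝ) (hS : S.Finite) (n : ℕ) (hn : S.ncard ≤ n) (D : ℝ) (hD : 0 ≤ D) :
    ∃ φ : ℝ → ℝ, (∀ y, |y - φ y| ≤ 4 * n * D) ∧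
      ∀ y z s, s ∈ S → |y - s| ≤ D → |y - z| ≤ D → φ y = φ z := by
  classical
  set N : Set ℝ := ⋃ s ∈ hS.toFinset, Set.Icc (s - 2 * D) (s + 2 * D) with hN
  have hvol : MeasureTheory.volume N ≤ ENNReal.ofReal (4 * n * D) := by
    calc MeasureTheory.volume N
        ≤ ∑ s ∈ hS.toFinset, MeasureTheory.volume (Set.Icc (s - 2 * D) (s + 2 * D)) :=
          MeasureTheory.measure_biUnion_finset_le _ _
      _ = ∑ s ∈ hS.toFinset, ENNReal.ofReal (4 * D) := by
          refine Finset.sum_congr rfl fun s _ => ?_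
          rw [Real.volume_Icc]; congr 1; ring
      _ = (S.ncard : ENNReal) * ENNReal.ofReal (4 * D) := by
          rw [Finset.sum_const, nsmul_eq_mul, Set.ncard_eq_toFinset_card S hS]
      _ ≤ (n : ENNReal) * ENNReal.ofReal (4 * D) := by gcongr
      _ = ENNReal.ofReal (4 * n * D) := by
          rw [← ENNReal.ofReal_natCast, ← ENNReal.ofReal_mul (by positivity)]; congr 1; ring
  have hfin : MeasureTheory.volume N ≠ ⊤ := ne_top_of_le_ne_top ENNReal.ofReal_ne_top hvol
  have hfin' : ∀ T, MeasureTheory.volume (N ∩ T) ≠ ⊤ := fun T =>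
    ne_top_of_le_ne_top hfin (MeasureTheory.measure_mono Set.inter_subset_left)
  have key : ∀ y z, y ≤ z → Set.Ioc y z ⊆ N →
      y - MeasureTheory.volume.real (N ∩ Set.Iic y) =
        z - MeasureTheory.volume.real (N ∩ Set.Iic z) := by
    intro y z hyz hsub
    have h1 : N ∩ Set.Iic z = (N ∩ Set.Iic y) ∪ Set.Ioc y z := by
      ext w
      constructor
      · rintro ⟨h1, h2⟩
        by_cases h : w ≤ y
        · exact Or.inl ⟨h1, h⟩
        · exact Or.inr ⟨not_le.1 h, h2⟩
      · rintro (⟨h1, h2⟩ | h)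
        · exact ⟨h1, le_trans h2 hyz⟩
        · exact ⟨hsub h, h.2⟩
    have h2 : Disjoint (N ∩ Set.Iic y) (Set.Ioc y z) := by
      rw [Set.disjoint_left]
      rintro w ⟨_, h⟩ h'
      exact absurd h (not_le.2 h'.1)
    rw [h1, MeasureTheory.measureReal_union h2 measurableSet_Ioc (hfin' _) (by simp),
      Real.volume_real_Ioc_of_le hyz]
    ring
  refine ⟨fun y => y - MeasureTheory.volume.real (N ∩ Set.Iic y), fun y => ?_, ?_⟩
  · have : MeasureTheory.volume.real (N ∩ Set.Iic y) ≤ 4 * n * D := by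
      apply ENNReal.toReal_le_of_le_ofReal (by positivity)
      exact (MeasureTheory.measure_mono Set.inter_subset_left).trans hvol
    rw [sub_sub_cancel, abs_of_nonneg MeasureTheory.measureReal_nonneg]
    exact this
  · intro y z s hs hys hyz
    rw [abs_le] at hys hyz
    have hin : ∀ w, s - 2 * D ≤ w → w ≤ s + 2 * D → w ∈ N := by
      intro w h1 h2
      rw [hN]
      exact Set.mem_biUnion (by simpa using hs) ⟨h1, h2⟩
    rcases le_total y z with h | h
    · exact key y z h fun w hw => hin w (by linarith [hw.1]) (by linarith [hw.2])
    · exact (key z y h fun w hw => hin w (by linarith [hw.1]) (by linarith [hw.2])).symm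

lemma aux_near {A B : Set ℝ} (hA : A.Finite) (hA' : A.Nonempty) (hB : B.Finite)
    (hB' : B.Nonempty) {r : ℝ} (h : hausdorffDist A B ≤ r) {y : ℝ} (hy : y ∈ A) :
    ∃ z ∈ B, |y - z| ≤ r := by
  obtain ⟨z, hz, hd⟩ := hB.isCompact.exists_infDist_eq_dist hB' y
  refine ⟨z, hz, ?_⟩
  rw [← Real.dist_eq, ← hd]
  exact (infDist_le_hausdorffDist_of_mem hy
    (hausdorffEDist_ne_top_of_nonempty_of_bounded hA' hB' hA.isBounded hB.isBounded)).trans h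

lemma aux_polar {E : Type*} [NormedAddCommGroup E] [NormedSpace ℝ E] [Nontrivial E]
    (c : E) (R : ℝ) (hR : 0 < R) (x : E) :
    ∃ p ∈ sphere c R, x - c = (‖x - c‖ / R) • (p - c) := by
  by_cases hx : x = c
  · obtain ⟨p, hp⟩ := (NormedSpace.sphere_nonempty (x := c) (r := R)).2 hR.le
    exact ⟨p, hp, by simp [hx]⟩
  · have h0 : ‖x - c‖ ≠ 0 := by simpa [sub_eq_zero] using hx
    refine ⟨c + (R / ‖x - c‖) • (x - c), ?_, ?_⟩
    · rw [mem_sphere, dist_eq_norm, add_sub_cancel_left, norm_smul, Real.norm_eq_abs,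
        abs_of_nonneg (by positivity)]
      field_simp
    · rw [add_sub_cancel_left, smul_smul]
      rw [show ‖x - c‖ / R * (R / ‖x - c‖) = 1 by field_simp, one_smul]


/-- **Lipschitz homotopy lemma (Kovalev).** `ℝ^(n)` is Lipschitz `k`-connected for every
`k`, with constant depending only on `n`: every `L`-Lipschitz map from the boundary sphere
of a closed ball in `ℝ^k` to `ℝ^(n)` extends to a `C_n L`-Lipschitz map on the whole ball. -/
theorem symmetric_product_lipschitz_connected (n : ℕ) (hn : 1 ≤ n) :
    ∃ C : ℝ, 0 < C ∧
      ∀ (k : ℕ), 1 ≤ k → ∀ (c : EuclideanSpace ℝ (Fin k)) (R L : ℝ), 0 < L →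
        ∀ f : EuclideanSpace ℝ (Fin k) → {A : Set ℝ // A.Finite ∧ A.Nonempty ∧ A.ncard ≤ n},
          (∀ x ∈ sphere c R, ∀ y ∈ sphere c R,
            hausdorffDist (f x).1 (f y).1 ≤ L * dist x y) →
          ∃ g : EuclideanSpace ℝ (Fin k) → {A : Set ℝ // A.Finite ∧ A.Nonempty ∧ A.ncard ≤ n},
            (∀ x ∈ closedBall c R, ∀ y ∈ closedBall c R,
              hausdorffDist (g x).1 (g y).1 ≤ C * L * dist x y) ∧
            (∀ x ∈ sphere c R, g x = f x) := by
  refine ⟨8 * n + 2, by positivity, ?_⟩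
  intro k hk c R L hL f hf
  rcases le_or_gt R 0 with hR | hR
  · refine ⟨f, ?_, fun _ _ => rfl⟩
    intro x hx y hy
    rw [mem_closedBall] at hx hy
    have hxc : x = c := dist_le_zero.1 (hx.trans hR)
    have hyc : y = c := dist_le_zero.1 (hy.trans hR)
    rw [hxc, hyc]
    simp
  have : Nonempty (Fin k) := ⟨⟨0, hk⟩⟩
  have : Nontrivial (EuclideanSpace ℝ (Fin k)) := inferInstance
  choose P hPs hP using aux_polar c R hR
  obtain ⟨φ, hφ1, hφ2⟩ := aux_phi (f (P c)).1 (f (P c)).2.1 n (f (P c)).2.2.2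
    (2 * L * R) (by positivity)
  have hnear : ∀ x y, ∀ a ∈ (f (P x)).1, ∃ b ∈ (f (P y)).1, |a - b| ≤ L * dist (P x) (P y) := by
    intro x y a ha
    exact aux_near (f (P x)).2.1 (f (P x)).2.2.1 (f (P y)).2.1 (f (P y)).2.2.1
      (hf _ (hPs x) _ (hPs y)) ha
  have hdist : ∀ x y, L * dist (P x) (P y) ≤ 2 * L * R := by
    intro x y
    have h1 := dist_triangle_right (P x) (P y) c
    have h2 := mem_sphere.1 (hPs x)
    have h3 := mem_sphere.1 (hPs y)
    nlinarith
  have hφ : ∀ x, ∀ a ∈ (f (P x)).1, ∀ b, |a - b| ≤ 2 * L * R → φ a = φ b := by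
    intro x a ha b hab
    obtain ⟨s, hs, has⟩ := hnear x c a ha
    exact hφ2 a b s hs (has.trans (hdist _ _)) hab
  let H : ℝ → ℝ → ℝ := fun t y => (1 - t) * φ y + t * y
  let T : EuclideanSpace ℝ (Fin k) → ℝ := fun x => ‖x - c‖ / R
  have hT0 : ∀ x, 0 ≤ T x := fun x => by positivity
  have hTd : ∀ x y, |T x - T y| * R ≤ dist x y := by
    intro x y
    have h1 : (T x - T y) * R = ‖x - c‖ - ‖y - c‖ := by
      simp only [T]; field_simp
    rw [← abs_of_pos hR, ← abs_mul, h1, dist_eq_norm]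
    have := abs_norm_sub_norm_le (x - c) (y - c)
    simpa using this
  have hTP : ∀ x y, T y * dist (P x) (P y) ≤ 2 * dist x y := by
    intro x y
    have e : T y • (P x - P y) = (x - y) - (T x - T y) • (P x - c) := by
      have h1 : x - c = T x • (P x - c) := hP x
      have h2 : y - c = T y • (P y - c) := hP y
      have h3 : x - y = T x • (P x - c) - T y • (P y - c) := by
        rw [← h1, ← h2]; abel
      rw [h3]; module
    calc T y * dist (P x) (P y) = ‖T y • (P x - P y)‖ := by
          rw [norm_smul, Real.norm_eq_abs, abs_of_nonneg (hT0 y), dist_eq_norm]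
      _ ≤ ‖x - y‖ + ‖(T x - T y) • (P x - c)‖ := by rw [e]; exact norm_sub_le _ _
      _ = dist x y + |T x - T y| * R := by
          rw [norm_smul, Real.norm_eq_abs, ← dist_eq_norm, ← dist_eq_norm,
            mem_sphere.1 (hPs x)]
      _ ≤ 2 * dist x y := by linarith [hTd x y]
  let g : EuclideanSpace ℝ (Fin k) → {A : Set ℝ // A.Finite ∧ A.Nonempty ∧ A.ncard ≤ n} :=
    fun x => ⟨H (T x) '' (f (P x)).1, (f (P x)).2.1.image _, (f (P x)).2.2.1.image _,
      (Set.ncard_image_le (f (P x)).2.1).trans (f (P x)).2.2.2⟩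
  have hmain : ∀ x y, ∀ u ∈ (g x).1, ∃ v ∈ (g y).1, dist u v ≤ (8 * n + 2) * L * dist x y := by
    rintro x y _ ⟨a, ha, rfl⟩
    obtain ⟨b, hb, hab⟩ := hnear x y a ha
    refine ⟨_, ⟨b, hb, rfl⟩, ?_⟩
    have he := hφ x a ha b (hab.trans (hdist _ _))
    have e2 : H (T x) a - H (T y) b = (T x - T y) * (a - φ a) + T y * (a - b) := by
      simp only [H]; rw [← he]; ring
    rw [Real.dist_eq, e2]
    have h1 : |T x - T y| * |a - φ a| ≤ 8 * n * L * dist x y := by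
      calc |T x - T y| * |a - φ a| ≤ |T x - T y| * (4 * n * (2 * L * R)) := by
            gcongr; exact hφ1 a
        _ = 8 * n * L * (|T x - T y| * R) := by ring
        _ ≤ 8 * n * L * dist x y := by gcongr; exact hTd x y
    have h2 : T y * |a - b| ≤ 2 * L * dist x y := by
      calc T y * |a - b| ≤ T y * (L * dist (P x) (P y)) := by
            gcongr
        _ = L * (T y * dist (P x) (P y)) := by ring
        _ ≤ L * (2 * dist x y) := by exact mul_le_mul_of_nonneg_left (hTP x y) hL.le
        _ = 2 * L * dist x y := by ring
    calc |(T x - T y) * (a - φ a) + T y * (a - b)|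
        ≤ |(T x - T y) * (a - φ a)| + |T y * (a - b)| := abs_add_le _ _
      _ = |T x - T y| * |a - φ a| + T y * |a - b| := by
          rw [abs_mul, abs_mul, abs_of_nonneg (hT0 y)]
      _ ≤ (8 * n + 2) * L * dist x y := by linarith
  refine ⟨g, ?_, ?_⟩
  · intro x _ y _
    refine hausdorffDist_le_of_mem_dist (by positivity) (hmain x y) ?_
    intro u hu
    rw [dist_comm x y]
    exact hmain y x u hu
  · intro x hx
    have hT1 : T x = 1 := by
      simp only [T]; rw [← dist_eq_norm, mem_sphere.1 hx]; field_simp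
    have hPx : P x = x := by
      have h1 : x - c = T x • (P x - c) := hP x
      rw [hT1, one_smul] at h1
      exact (sub_left_injective h1).symm
    apply Subtype.ext
    change H (T x) '' (f (P x)).1 = (f x).1
    rw [hT1, hPx]
    have : H 1 = id := by funext y; simp [H]
    rw [this, Set.image_id]
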